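/- Let n be any integer, m ≥ 1, and 1 ≤ d ≤ m+1. Let (L_n(x))_{n∈ℤ} be the sequence of Lucas polynomials and (F_n(x))_{n∈ℤ} the sequence of Fibonacci polynomials. Then the determinant of the d×d matrix with (i,j) entry L_{n+i+j}(x)^{⟨m⟩} (indices 0 ≤ i, j ≤ d−1) equals (−1)^{(n+1)·C(d,2) + C(d+1,3)} · (x²+4)^{C(d,2)} · ∏_{i=1}^{d−1} ( F_i(x) · F_{m+1−i}(x) )^{d−i} · ∏_{i=d−1}^{2(d−1)} L_{n+i}(x)^{⟨m+1−d⟩}, where C(·,·) are binomial coefficients; this is an identity of real polynomials. -/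

import Mathlib

open Polynomial Finset

/-- Products over pairs `i < j` in `Fin d`, rewritten with natural number indices. -/
theorem prod_univ_prod_Ioi_eq_prod_range {M : Type*} [CommMonoid M] (d : ℕ) (f : ℕ → ℕ → M) :
    ∏ i : Fin d, ∏ j ∈ Ioi i, f i j = ∏ j ∈ range d, ∏ i ∈ range j, f i j := by
  have h (i : Fin d) : ∏ j ∈ Ioi i, f i j = ∏ j ∈ range d, if i.1 < j then f i j else 1 := by
    rw [← Fin.prod_univ_eq_prod_range (fun j => if i.1 < j then f i j else 1), ← prod_filter]
    refine prod_congr ?_ fun _ _ => rfl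
    ext j
    simp
  simp_rw [h]
  rw [Fin.prod_univ_eq_prod_range (fun i => ∏ j ∈ range d, if i < j then f i j else 1), prod_comm]
  refine prod_congr rfl fun j hj => ?_
  rw [← prod_filter]
  refine prod_congr ?_ fun _ _ => rfl
  ext i
  simp only [mem_filter, mem_range] at hj ⊢
  omega

theorem prod_range_prod_range_sub {M : Type*} [CommMonoid M] (d : ℕ) (g : ℕ → M) :
    ∏ j ∈ range d, ∏ i ∈ range j, g (j - i) = ∏ t ∈ Icc 1 (d - 1), g t ^ (d - t) := by
  have key (d : ℕ) :
      ∏ j ∈ range (d + 1), ∏ i ∈ range j, g (j - i) = ∏ t ∈ Icc 1 d, g t ^ (d + 1 - t) := by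
    induction d with
    | zero => simp
    | succ d ih =>
      have h1 : ∏ i ∈ range (d + 1), g (d + 1 - i) = ∏ t ∈ Icc 1 (d + 1), g t := by
        rw [← prod_range_reflect, range_eq_Ico, prod_Ico_eq_prod_range, ← Ico_add_one_right_eq_Icc,
          prod_Ico_eq_prod_range]
        refine prod_congr rfl fun t ht => congrArg g ?_
        simp only [mem_range] at ht
        omega
      have h2 : ∏ t ∈ Icc 1 d, g t ^ (d + 1 - t) = ∏ t ∈ Icc 1 (d + 1), g t ^ (d + 1 - t) := by
        rw [prod_Icc_succ_top (by omega)]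
        simp
      rw [prod_range_succ, ih, h1, h2, ← prod_mul_distrib]
      refine prod_congr rfl fun t ht => ?_
      rw [← pow_succ]
      congr 1
      simp only [mem_Icc] at ht
      omega
  cases d with
  | zero => simp
  | succ d => exact key d

theorem prod_range_prod_range_pred_sub {M : Type*} [CommMonoid M] (d : ℕ) (g : ℕ → M) :
    ∏ i ∈ range d, ∏ u ∈ range (d - 1 - i), g u
      = ∏ j ∈ range d, ∏ i ∈ range j, g (j - 1 - i) := by
  rw [prod_range_reflect (fun i => ∏ u ∈ range i, g u)]
  exact prod_congr rfl fun j _ => (prod_range_reflect g j).symm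

theorem prod_range_prod_range_zpow {K : Type*} [CommGroup K] (a : K) (d : ℕ) (c : ℤ) :
    ∏ j ∈ range d, ∏ i ∈ range j, a ^ (c + ((j - i : ℕ) : ℤ))
      = a ^ (c * (d.choose 2 : ℤ) + ((d + 1).choose 3 : ℤ)) := by
  have key (j : ℕ) : ∏ i ∈ range j, a ^ (c + ((j - i : ℕ) : ℤ))
      = a ^ (c * j + ((j + 1).choose 2 : ℤ)) := by
    induction j with
    | zero => simp
    | succ j ih =>
      rw [prod_range_succ']
      simp only [Nat.add_sub_add_right, Nat.sub_zero]
      rw [ih, ← zpow_add, Nat.choose_succ_succ' (j + 1) 1, Nat.choose_one_right]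
      congr 1
      push_cast
      ring
  induction d with
  | zero => simp [Nat.choose]
  | succ d ih =>
    rw [prod_range_succ, ih, key, ← zpow_add, Nat.choose_succ_succ' (d + 1) 2,
      show (d + 1).choose 2 = d + d.choose 2 by rw [Nat.choose_succ_succ' d 1, Nat.choose_one_right]]
    congr 1
    push_cast
    ring

/-- A product of `N` binary linear forms is a binary form of degree `N`. -/
theorem exists_prod_linear_eq_sum {R : Type*} [CommRing R] (N : ℕ) (a b : ℕ → R) :
    ∃ c : ℕ → R, ∀ p q : R, ∏ u ∈ range N, (a u * p + b u * q)
      = ∑ k ∈ range (N + 1), p ^ k * q ^ (N - k) * c k := by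
  refine ⟨fun k => ∑ t ∈ powersetCard k (range N), (∏ u ∈ t, a u) * ∏ u ∈ range N \ t, b u,
    fun p q => ?_⟩
  rw [prod_add, sum_powerset, card_range]
  refine sum_congr rfl fun k _ => ?_
  rw [mul_sum]
  refine sum_congr rfl fun t ht => ?_
  obtain ⟨hts, htk⟩ := mem_powersetCard.1 ht
  rw [prod_mul_distrib, prod_mul_distrib, prod_const, prod_const, card_sdiff_of_subset hts,
    card_range, htk]
  ring

section Recurrence

variable {R : Type*} [CommRing R] {x : R} {F : ℤ → R}

theorem recurrence_add (hF0 : F 0 = 0) (hF1 : F 1 = 1)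
    (hF : ∀ k : ℤ, F (k + 2) = x * F (k + 1) + F k)
    {G : ℤ → R} (hG : ∀ k : ℤ, G (k + 2) = x * G (k + 1) + G k) (k u : ℤ) :
    G (k + u) = F (u - 1) * G k + F u * G (k + 1) := by
  suffices h : G (k + u) = F (u - 1) * G k + F u * G (k + 1) ∧
      G (k + u + 1) = F u * G k + F (u + 1) * G (k + 1) from h.1
  induction u using Int.induction_on with
  | zero =>
    have h := hF (-1)
    norm_num [hF0, hF1] at h
    simp [hF0, hF1, ← h]
  | succ u ih =>
    have h1 := hF u
    have h2 := hG (k + u)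
    have h3 := hF (u - 1)
    rw [show (u : ℤ) - 1 + 2 = u + 1 by ring, show (u : ℤ) - 1 + 1 = u by ring] at h3
    refine ⟨by simpa [add_assoc] using ih.2, ?_⟩
    rw [show k + ((u : ℤ) + 1) + 1 = k + u + 2 by ring, show (u : ℤ) + 1 + 1 = u + 2 by ring,
      h1, h2, ih.1, ih.2]
    linear_combination -G k * h3
  | pred u ih =>
    have h1 := hF (-u - 1)
    have h2 := hG (k + (-u - 1))
    have h3 := hF (-u - 1 - 1)
    rw [show -(u : ℤ) - 1 + 2 = -u + 1 by ring, show -(u : ℤ) - 1 + 1 = -u by ring] at h1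
    rw [show -(u : ℤ) - 1 - 1 + 2 = -u by ring, show -(u : ℤ) - 1 - 1 + 1 = -u - 1 by ring] at h3
    rw [show k + (-(u : ℤ) - 1) + 2 = k + -u + 1 by ring,
      show k + (-(u : ℤ) - 1) + 1 = k + -u by ring, ih.1, ih.2] at h2
    rw [show k + (-(u : ℤ) - 1) + 1 = k + -u by ring, show -(u : ℤ) - 1 + 1 = -u by ring]
    refine ⟨?_, ih.1⟩
    linear_combination -h2 + G k * h3 + G (k + 1) * h1

/-- The quadratic form preserved up to sign by the recurrence. -/
theorem recurrence_invariant {G : ℤ → R} (hG : ∀ k : ℤ, G (k + 2) = x * G (k + 1) + G k) (b : ℤ) :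
    G (b + 1) ^ 2 - x * G b * G (b + 1) - G b ^ 2
      = (((-1 : Rˣ) ^ b : Rˣ) : R) * (G 1 ^ 2 - x * G 0 * G 1 - G 0 ^ 2) := by
  induction b using Int.induction_on with
  | zero => simp
  | succ b ih =>
    have h := hG b
    rw [zpow_add, zpow_one, add_assoc (b : ℤ), show (1 : ℤ) + 1 = 2 by norm_num, h]
    push_cast
    linear_combination -ih
  | pred b ih =>
    have h := hG (-b - 1)
    rw [show -(b : ℤ) - 1 + 2 = -b + 1 by ring, show -(b : ℤ) - 1 + 1 = -b by ring] at h
    rw [h] at ih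
    rw [zpow_sub, zpow_one, show -(b : ℤ) - 1 + 1 = -b by ring]
    push_cast [inv_neg, inv_one]
    linear_combination -ih

theorem recurrence_cross (hF0 : F 0 = 0) (hF1 : F 1 = 1)
    (hF : ∀ k : ℤ, F (k + 2) = x * F (k + 1) + F k)
    {G : ℤ → R} (hG : ∀ k : ℤ, G (k + 2) = x * G (k + 1) + G k) (b t : ℤ) :
    G (b + t) * G (b + 1) - G b * G (b + t + 1)
      = (((-1 : Rˣ) ^ b : Rˣ) : R) * (G 1 ^ 2 - x * G 0 * G 1 - G 0 ^ 2) * F t := by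
  have h1 := recurrence_add hF0 hF1 hF hG b t
  have h2 := recurrence_add hF0 hF1 hF hG b (t + 1)
  have h3 := hF (t - 1)
  rw [show t - 1 + 2 = t + 1 by ring, show t - 1 + 1 = t by ring] at h3
  rw [show t + 1 - 1 = t by ring, ← add_assoc] at h2
  rw [← recurrence_invariant hG, h1, h2, h3]
  ring

theorem fib_neg (hF0 : F 0 = 0) (hF1 : F 1 = 1)
    (hF : ∀ k : ℤ, F (k + 2) = x * F (k + 1) + F k) (t : ℤ) :
    F (-t) = (((-1 : Rˣ) ^ (t + 1) : Rˣ) : R) * F t := by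
  have h := recurrence_cross hF0 hF1 hF hF t (-t)
  rw [add_neg_cancel, zero_add, hF0, hF1] at h
  rw [zpow_add, zpow_one]
  have h2 : (((-1 : Rˣ) ^ t : Rˣ) : R) * (((-1 : Rˣ) ^ t : Rˣ) : R) = 1 := by
    rw [← Units.val_mul, ← mul_zpow]
    simp
  push_cast
  linear_combination -((((-1 : Rˣ) ^ t : Rˣ) : R) * h) - F (-t) * h2

/-- The determinant of a matrix of products of `d - 1` terms of solutions of the recurrence is a
projective Vandermonde determinant times a factor not depending on the solutions. -/
theorem exists_det_prod_recurrence (hF0 : F 0 = 0) (hF1 : F 1 = 1)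
    (hF : ∀ k : ℤ, F (k + 2) = x * F (k + 1) + F k) (d m : ℕ) :
    ∃ D : R, ∀ G : ℕ → ℤ → R, (∀ i k, G i (k + 2) = x * G i (k + 1) + G i k) →
      (Matrix.of fun i j : Fin d => (∏ u ∈ range (d - 1 - j), G i (j + u : ℕ))
          * ∏ u ∈ range j, G i (m + u : ℕ)).det
        = (∏ j ∈ range d, ∏ i ∈ range j, (G j 0 * G i 1 - G i 0 * G j 1)) * D := by
  set e : ℕ → ℕ → ℤ := fun j u =>
    if u < d - 1 - j then (j + u : ℕ) else (m + (u - (d - 1 - j)) : ℕ) with he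
  choose c hc using fun j : ℕ =>
    exists_prod_linear_eq_sum (d - 1) (fun u => F (e j u - 1)) (fun u => F (e j u))
  refine ⟨(Matrix.of fun k j : Fin d => c j k).det, fun G hG => ?_⟩
  rw [← prod_univ_prod_Ioi_eq_prod_range d fun i j => G j 0 * G i 1 - G i 0 * G j 1,
    ← Matrix.det_projVandermonde (fun i : Fin d => G i 0) (fun i : Fin d => G i 1),
    ← Matrix.det_mul]
  congr 1
  ext i j
  have hj := j.2
  simp only [Matrix.of_apply, Matrix.mul_apply, Matrix.projVandermonde_apply, Fin.val_rev]
  have h := hc j (G i 0) (G i 1)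
  have hadd (k : ℤ) : F (k - 1) * G i 0 + F k * G i 1 = G i k := by
    simpa using (recurrence_add hF0 hF1 hF (hG i) 0 k).symm
  simp only [hadd] at h
  rw [Fin.sum_univ_eq_sum_range (fun k => G i 0 ^ k * G i 1 ^ (d - (k + 1)) * c j k)]
  obtain ⟨d, rfl⟩ : ∃ e, d = e + 1 := ⟨d - 1, by omega⟩
  simp only [Nat.add_sub_cancel, Nat.add_sub_add_right] at h he ⊢
  rw [← h]
  have hsplit : ∏ u ∈ range d, G i (e j u)
      = (∏ u ∈ range (d - j), G i (e j u)) * ∏ u ∈ range j, G i (e j (d - j + u)) := by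
    rw [← prod_range_add, Nat.sub_add_cancel (Nat.lt_succ_iff.1 hj)]
  rw [hsplit]
  congr 1
  · refine prod_congr rfl fun u hu => ?_
    rw [he]
    simp only [mem_range] at hu
    simp only [if_pos hu]
  · refine prod_congr rfl fun u hu => ?_
    rw [he]
    simp

theorem det_prod_fib_shift (hF0 : F 0 = 0) (d m : ℕ) :
    (Matrix.of fun i j : Fin d => (∏ u ∈ range (d - 1 - j), F ((j + u : ℕ) - m - i))
          * ∏ u ∈ range j, F ((m + u : ℕ) - m - i)).det
      = ∏ j ∈ range d, ∏ i ∈ range j, F ((j - 1 - i : ℕ) - m) * F (i - j) := by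
  rw [Matrix.det_of_isLowerTriangular]
  · simp only [Matrix.of_apply]
    rw [Fin.prod_univ_eq_prod_range (fun i => (∏ u ∈ range (d - 1 - i), F ((i + u : ℕ) - m - i))
          * ∏ u ∈ range i, F ((m + u : ℕ) - m - i))]
    simp only [prod_mul_distrib]
    rw [← prod_range_prod_range_pred_sub d fun u => F (u - m)]
    congr 1
    · refine prod_congr rfl fun i _ => prod_congr rfl fun u _ => congrArg F ?_
      push_cast
      ring
    · refine prod_congr rfl fun i _ => prod_congr rfl fun u _ => congrArg F ?_
      push_cast
      ring
  · intro i j hij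
    have hij : i < j := hij
    rw [Matrix.of_apply, prod_eq_zero (i := i.1) (s := range j) (by simpa using hij), mul_zero]
    rw [← hF0]
    congr 1
    push_cast
    ring

end Recurrence

theorem fibonacci_polynomial_ne_zero {F : ℤ → ℝ[X]} (hF0 : F 0 = 0) (hF1 : F 1 = 1)
    (hF : ∀ k : ℤ, F (k + 2) = X * F (k + 1) + F k) (t : ℕ) : F (t + 1) ≠ 0 := by
  have h (t : ℕ) : 0 ≤ (F t).eval 1 ∧ 0 < (F (t + 1)).eval 1 := by
    induction t with
    | zero => simp [hF0, hF1]
    | succ t ih =>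
      have h := congrArg (eval 1) (hF t)
      simp only [eval_add, eval_mul, eval_X, one_mul] at h
      push_cast
      rw [add_assoc (t : ℤ), show (1 : ℤ) + 1 = 2 by norm_num, h]
      exact ⟨ih.2.le, by linarith [ih.1, ih.2]⟩
  intro h0
  simpa [h0] using (h t).2

theorem C_neg_one_zpow (k : ℤ) : C ((-1 : ℝ) ^ k) = (((-1 : ℝ[X]ˣ) ^ k : ℝ[X]ˣ) : ℝ[X]) := by
  rcases Int.even_or_odd k with hk | hk <;> simp [hk.neg_one_zpow]

/-- Splitting off the factors common to a row of the rising power matrix. -/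
theorem prod_range_split {M : Type*} [CommMonoid M] {m d j : ℕ} (hj : j < d) (hdm : d ≤ m + 1)
    (G : ℤ → M) :
    ∏ u ∈ range m, G (j + u)
      = (∏ u ∈ range (m + 1 - d), G ((d - 1 : ℕ) + u))
        * ((∏ u ∈ range (d - 1 - j), G (j + u : ℕ)) * ∏ u ∈ range j, G (m + u : ℕ)) := by
  conv_lhs => rw [show m = (d - 1 - j) + (m + 1 - d) + j by omega, prod_range_add, prod_range_add]
  rw [← mul_assoc, mul_comm (∏ u ∈ range (m + 1 - d), _)]
  congr 1
  · congr 1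
    exact prod_congr rfl fun u _ => congrArg G (by omega)
  · exact prod_congr rfl fun u _ => congrArg G (by omega)

theorem det_prod_lucas_shift {L F : ℤ → ℝ[X]} (hL0 : L 0 = 2) (hL1 : L 1 = X)
    (hL : ∀ k : ℤ, L (k + 2) = X * L (k + 1) + L k) (hF0 : F 0 = 0) (hF1 : F 1 = 1)
    (hF : ∀ k : ℤ, F (k + 2) = X * F (k + 1) + F k) (n : ℤ) (d m : ℕ) :
    (Matrix.of fun i j : Fin d => (∏ u ∈ range (d - 1 - j), L (n + i + (j + u : ℕ)))
          * ∏ u ∈ range j, L (n + i + (m + u : ℕ))).det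
      = ∏ j ∈ range d, ∏ i ∈ range j, ((((-1 : ℝ[X]ˣ) ^ (n + 1 + ((j - i : ℕ) : ℤ)) : ℝ[X]ˣ) : ℝ[X])
          * (X ^ 2 + C 4) * (F (j - i : ℕ) * F (m + 1 - (j - i : ℕ)))) := by
  obtain ⟨D, hD⟩ := exists_det_prod_recurrence hF0 hF1 hF d m
  have hdet := hD (fun i k => L (n + i + k)) fun i k => by
    simpa only [add_assoc] using hL (n + i + k)
  have hdet' := hD (fun i k => F (k - m - i)) fun i k => by
    have h := hF (k - m - i)
    rwa [show k - m - i + 2 = k + 2 - m - (i : ℤ) by ring,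
      show k - m - i + 1 = k + 1 - m - (i : ℤ) by ring] at h
  have hfib := det_prod_fib_shift hF0 d m
  rw [hdet'] at hfib
  have hcross (i j : ℕ) : F (0 - m - j) * F (1 - m - i) - F (0 - m - i) * F (1 - m - j)
      = (((-1 : ℝ[X]ˣ) ^ (-m - i : ℤ) : ℝ[X]ˣ) : ℝ[X]) * F (i - j) := by
    have h := recurrence_cross hF0 hF1 hF hF (-m - i) (i - j)
    rw [hF0, hF1] at h
    convert h using 1
    · ring_nf
    · ring
  have hne : ∏ j ∈ range d, ∏ i ∈ range j,
      (F (0 - m - j) * F (1 - m - i) - F (0 - m - i) * F (1 - m - j)) ≠ 0 := by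
    refine prod_ne_zero_iff.2 fun j _ => prod_ne_zero_iff.2 fun i hi => ?_
    obtain ⟨t, rfl⟩ := Nat.exists_eq_add_of_lt (mem_range.1 hi)
    rw [hcross, show (i : ℤ) - (i + t + 1 : ℕ) = -(t + 1) by push_cast; ring,
      fib_neg hF0 hF1 hF]
    exact mul_ne_zero (Units.ne_zero _)
      (mul_ne_zero (Units.ne_zero _) (fibonacci_polynomial_ne_zero hF0 hF1 hF t))
  rw [hdet]
  refine mul_left_cancel₀ hne ?_
  rw [mul_left_comm, hfib]
  simp only [← prod_mul_distrib]
  refine prod_congr rfl fun j _ => prod_congr rfl fun i hi => ?_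
  obtain ⟨t, rfl⟩ := Nat.exists_eq_add_of_lt (mem_range.1 hi)
  have hlucas := recurrence_cross hF0 hF1 hF hL (n + i) (t + 1)
  rw [hcross, show i + t + 1 - 1 - i = t by omega, show i + t + 1 - i = t + 1 by omega]
  rw [show n + ((i + t + 1 : ℕ) : ℤ) + 0 = n + i + (t + 1) by push_cast; ring,
    show n + ((i + t + 1 : ℕ) : ℤ) + 1 = n + i + (t + 1) + 1 by push_cast; ring, add_zero, hlucas,
    show (t : ℤ) - m = -(m + 1 - (t + 1 : ℕ)) by push_cast; ring, fib_neg hF0 hF1 hF, hL0, hL1]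
  have hsign : (((-1 : ℝ[X]ˣ) ^ (-m - i : ℤ) : ℝ[X]ˣ) : ℝ[X])
        * (((-1 : ℝ[X]ˣ) ^ (n + 1 + ((t + 1 : ℕ) : ℤ)) : ℝ[X]ˣ) : ℝ[X])
      = -((((-1 : ℝ[X]ˣ) ^ (n + i) : ℝ[X]ˣ) : ℝ[X])
        * (((-1 : ℝ[X]ˣ) ^ ((m : ℤ) + 1 - (t + 1 : ℕ) + 1) : ℝ[X]ˣ) : ℝ[X])) := by
    rw [← Units.val_mul, ← Units.val_mul, ← Units.val_neg, ← zpow_add, ← zpow_add,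
      neg_eq_neg_one_mul ((-1 : ℝ[X]ˣ) ^ _), ← zpow_one_add]
    congr 1
    rw [← mul_inv_eq_one, ← zpow_neg, ← zpow_add]
    refine Even.neg_one_zpow ⟨t - m - i, ?_⟩
    push_cast
    ring
  push_cast at hsign ⊢
  rw [show (C (4 : ℝ) : ℝ[X]) = 4 from map_ofNat C 4]
  linear_combination
    -(F (i - (i + t + 1)) * (X ^ 2 + 4) * F (t + 1) * F (m + 1 - (t + 1))) * hsign

/-- **Corollary 3, fourth identity.** For the Lucas polynomials `(L_n(x))_{n∈ℤ}` and
Fibonacci polynomials `(F_n(x))_{n∈ℤ}`, `m ≥ 1` and `1 ≤ d ≤ m+1`, the determinant of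
the `d×d` matrix with entries the rising powers `L_{n+i+j}(x)^{⟨m⟩}` equals
`(−1)^{(n+1)·C(d,2)+C(d+1,3)} (x²+4)^{C(d,2)} · ∏_{i=1}^{d−1} (F_i(x) F_{m+1−i}(x))^{d−i}
 · ∏_{i=d−1}^{2(d−1)} L_{n+i}(x)^{⟨m+1−d⟩}`. -/
theorem det_rising_power_matrix_lucas_polynomials
    (n : ℤ) (m d : ℕ) (hm : 1 ≤ m) (hd : 1 ≤ d) (hdm : d ≤ m + 1)
    (L F : ℤ → Polynomial ℝ)
    (hL0 : L 0 = 2) (hL1 : L 1 = X)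
    (hLrec : ∀ n : ℤ, L (n + 2) = X * L (n + 1) + L n)
    (hF0 : F 0 = 0) (hF1 : F 1 = 1)
    (hFrec : ∀ n : ℤ, F (n + 2) = X * F (n + 1) + F n) :
    Matrix.det (Matrix.of fun i j : Fin d =>
        ∏ u ∈ Finset.range m, L (n + i.1 + j.1 + u))
      = Polynomial.C ((-1 : ℝ)
            ^ ((n + 1) * (Nat.choose d 2 : ℤ) + (Nat.choose (d + 1) 3 : ℤ)))
        * (X ^ 2 + Polynomial.C 4) ^ (Nat.choose d 2)
        * (∏ i ∈ Finset.Icc 1 (d - 1),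
            (F (i : ℤ) * F ((m : ℤ) + 1 - (i : ℤ))) ^ (d - i))
        * ∏ i ∈ Finset.Icc (d - 1) (2 * (d - 1)),
            ∏ u ∈ Finset.range (m + 1 - d), L (n + i + u) := by
  have hfactor : (Matrix.of fun i j : Fin d => ∏ u ∈ Finset.range m, L (n + i.1 + j.1 + u))
      = Matrix.of fun i j : Fin d => (∏ u ∈ range (m + 1 - d), L (n + (d - 1 + i : ℕ) + u))
        * (Matrix.of fun i j : Fin d => (∏ u ∈ range (d - 1 - j), L (n + i + (j + u : ℕ)))
          * ∏ u ∈ range j, L (n + i + (m + u : ℕ))) i j := by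
    ext1 i j
    have h := prod_range_split j.2 hdm fun k => L (n + i + k)
    simp only [Matrix.of_apply]
    simp only [add_assoc] at h ⊢
    rw [h]
    congr 1
    refine prod_congr rfl fun u _ => congrArg L ?_
    push_cast
    ring
  have hrow : ∏ i ∈ Icc (d - 1) (2 * (d - 1)), ∏ u ∈ range (m + 1 - d), L (n + i + u)
      = ∏ i : Fin d, ∏ u ∈ range (m + 1 - d), L (n + (d - 1 + i : ℕ) + u) := by
    rw [Fin.prod_univ_eq_prod_range
        (fun i => ∏ u ∈ range (m + 1 - d), L (n + (d - 1 + i : ℕ) + u)),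
      ← Ico_add_one_right_eq_Icc, prod_Ico_eq_prod_range,
      show 2 * (d - 1) + 1 - (d - 1) = d by omega]
  have hsq : ∏ j ∈ range d, ∏ i ∈ range j, (X ^ 2 + C 4 : ℝ[X]) = (X ^ 2 + C 4) ^ d.choose 2 := by
    simp only [prod_const, card_range]
    rw [prod_pow_eq_pow_sum, sum_range_id, Nat.choose_two_right]
  rw [hfactor, Matrix.det_mul_column, det_prod_lucas_shift hL0 hL1 hLrec hF0 hF1 hFrec, hrow,
    C_neg_one_zpow, ← prod_range_prod_range_zpow, ← hsq,
    ← prod_range_prod_range_sub d fun t : ℕ => F t * F (m + 1 - t)]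
  simp only [prod_mul_distrib]
  push_cast
  ring
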